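/- Row-boundary sum for the two-step coefficients (ℓ = d column): let λ be a Young diagram with at most d rows, let i, j ∈ [d], and assume λ + e_i is again a Young diagram, i.e. i = 1 or λ_{i−1} > λ_i. Set B_{ij} := (C_i − C_d) · D_{d→ij} − (C_i − C_d + 1) · D_{d−1→ij}. Then ∑_{k=1}^{d} λ↑↑_k · g(k, d) = B_{ij} + (C_d + 1) · (F(d, d) − F(d, d−1)). -/

import Mathlib

open Finset

/-- The Weyl dimension polynomial `WD_p(mu) = prod_{1 <= a < b <= p} ((mu_a - mu_b) + (b - a))/(b - a)`
of the integer tuple `(mu 1, ..., mu p)`. -/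
def weylDim (p : ℕ) (μ : ℕ → ℤ) : ℚ :=
  ∏ a ∈ Finset.Icc 1 p, ∏ b ∈ Finset.Icc (a + 1) p,
    (((μ a : ℚ) - (μ b : ℚ)) + ((b : ℚ) - (a : ℚ))) / ((b : ℚ) - (a : ℚ))

/-- `addBox μ y = μ + e_y`: the tuple `μ` with `1` added in coordinate `y`. -/
def addBox (μ : ℕ → ℤ) (y : ℕ) : ℕ → ℤ := fun x => μ x + if x = y then 1 else 0

/-- The dimension ratio `D^μ_{k→y} = WD_k(μ + e_y)/WD_k(μ)` for `y ≤ k`, and `0` for `k < y`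
(division by zero evaluates to `0`). -/
def dimRatio (μ : ℕ → ℤ) (k y : ℕ) : ℚ :=
  if y ≤ k then weylDim k (addBox μ y) / weylDim k μ else 0

def intOf (lam : ℕ → ℕ) : ℕ → ℤ := fun x => (lam x : ℤ)

/-- `Δ = (λ_j − λ_i) + (i − j) + δ_{ij}`. -/
def Del (lam : ℕ → ℕ) (i j : ℕ) : ℚ :=
  (((lam j : ℚ) - (lam i : ℚ)) + ((i : ℚ) - (j : ℚ))) + (if i = j then 1 else 0)

/-- The partial-sum function `F(s, t)` of squared two-step Clebsch–Gordan coefficients. -/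
def Fcoef (lam : ℕ → ℕ) (i j : ℕ) (s t : ℕ) : ℚ :=
  if s ≤ t then dimRatio (intOf lam) s i * dimRatio (addBox (intOf lam) i) t j
  else
    dimRatio (intOf lam) t j * dimRatio (addBox (intOf lam) j) s i
      + 1 / Del lam i j ^ 2 *
          (dimRatio (intOf lam) t i * dimRatio (addBox (intOf lam) i) s j
            - dimRatio (intOf lam) t j * dimRatio (addBox (intOf lam) j) s i)

/-- The squared two-step Clebsch–Gordan coefficient `g(k, ℓ)`. -/
def gcoef (lam : ℕ → ℕ) (i j : ℕ) (k l : ℕ) : ℚ :=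
  Fcoef lam i j k l - Fcoef lam i j (k - 1) l - Fcoef lam i j k (l - 1)
    + Fcoef lam i j (k - 1) (l - 1)

/-- `D_{s→ij}`. -/
def dimR2 (lam : ℕ → ℕ) (i j s : ℕ) : ℚ :=
  if max i j ≤ s then weylDim s (addBox (addBox (intOf lam) i) j) / weylDim s (intOf lam)
  else 0

/-- `C^{λ+e_i}_j = λ_j + δ_{ij} − j`. -/
def rowContentAdd (lam : ℕ → ℕ) (i j : ℕ) : ℚ :=
  ((lam j : ℚ) + (if i = j then 1 else 0)) - (j : ℚ)

/-- The content `C_x = λ_x − x` of row `x`. -/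
def rowContent (lam : ℕ → ℕ) (x : ℕ) : ℚ := (lam x : ℚ) - (x : ℚ)

/-- The staircase transformation `λ↑↑_k = λ_k + d − 2k + 1`. -/
def staircase (d : ℕ) (lam : ℕ → ℕ) (k : ℕ) : ℤ :=
  (lam k : ℤ) + (d : ℤ) - 2 * (k : ℤ) + 1

theorem weylDim_pos {p : ℕ} {μ : ℕ → ℤ} (h : ∀ a b, 1 ≤ a → a ≤ b → b ≤ p → μ b ≤ μ a) :
    0 < weylDim p μ := by
  refine Finset.prod_pos fun a ha => Finset.prod_pos fun b hb => ?_
  simp only [Finset.mem_Icc] at ha hb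
  have hab : (a : ℚ) < b := by exact_mod_cast hb.1
  have hμ : (μ b : ℚ) ≤ μ a := by exact_mod_cast h a b ha.1 (by omega) hb.2
  exact div_pos (by linarith) (by linarith)

theorem weylDim_succ (p : ℕ) (μ : ℕ → ℤ) :
    weylDim (p + 1) μ = weylDim p μ * ∏ a ∈ Finset.Icc 1 p,
      ((μ a : ℚ) - μ (p + 1) + (((p + 1 : ℕ) : ℚ) - a)) / (((p + 1 : ℕ) : ℚ) - a) := by
  unfold weylDim
  rw [Finset.prod_Icc_succ_top (by omega : 1 ≤ p + 1), Finset.Icc_eq_empty (by omega : ¬ p + 1 + 1 ≤ p + 1),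
    Finset.prod_empty, mul_one, ← Finset.prod_mul_distrib]
  refine Finset.prod_congr rfl fun a ha => ?_
  rw [Finset.prod_Icc_succ_top (by have := (Finset.mem_Icc.mp ha).2; omega)]

/-- The dimension ratios of consecutive truncations satisfy a two-term recursion in terms of the
contents of row `i` and of the last row. -/
theorem dimRatio_succ {p i : ℕ} {μ : ℕ → ℤ}
    (h : ∀ a b, 1 ≤ a → a ≤ b → b ≤ p + 1 → μ b ≤ μ a) (hi : 1 ≤ i) (hip : i ≤ p + 1) :
    (((μ i : ℚ) - i) - (μ (p + 1) - ((p + 1 : ℕ) : ℚ))) * dimRatio μ (p + 1) i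
      = (((μ i : ℚ) - i) - (μ (p + 1) - ((p + 1 : ℕ) : ℚ)) + 1) * dimRatio μ p i := by
  rcases hip.eq_or_lt with rfl | hlt
  · simp [dimRatio]
  have hmem : i ∈ Finset.Icc 1 p := Finset.mem_Icc.mpr ⟨hi, by omega⟩
  have hw1 := (weylDim_pos h).ne'
  have hw := (weylDim_pos (p := p) fun a b ha hab hb => h a b ha hab (by omega)).ne'
  have hpi : ((p + 1 : ℕ) : ℚ) - i ≠ 0 := by
    have : (i : ℚ) < ((p + 1 : ℕ) : ℚ) := by exact_mod_cast hlt
    linarith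
  have hstep : (((μ i : ℚ) - i) - (μ (p + 1) - ((p + 1 : ℕ) : ℚ)))
        * ∏ a ∈ Finset.Icc 1 p, ((addBox μ i a : ℚ) - addBox μ i (p + 1)
          + (((p + 1 : ℕ) : ℚ) - a)) / (((p + 1 : ℕ) : ℚ) - a)
      = (((μ i : ℚ) - i) - (μ (p + 1) - ((p + 1 : ℕ) : ℚ)) + 1)
        * ∏ a ∈ Finset.Icc 1 p, ((μ a : ℚ) - μ (p + 1)
          + (((p + 1 : ℕ) : ℚ) - a)) / (((p + 1 : ℕ) : ℚ) - a) := by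
    rw [← Finset.mul_prod_erase _ _ hmem, ← Finset.mul_prod_erase _ _ hmem]
    have hne : p + 1 ≠ i := by omega
    have hrest : ∏ a ∈ (Finset.Icc 1 p).erase i, ((addBox μ i a : ℚ) - addBox μ i (p + 1)
          + (((p + 1 : ℕ) : ℚ) - a)) / (((p + 1 : ℕ) : ℚ) - a)
        = ∏ a ∈ (Finset.Icc 1 p).erase i, ((μ a : ℚ) - μ (p + 1)
          + (((p + 1 : ℕ) : ℚ) - a)) / (((p + 1 : ℕ) : ℚ) - a) := by
      refine Finset.prod_congr rfl fun a ha => ?_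
      simp [addBox, Finset.ne_of_mem_erase ha, hne]
    rw [hrest]
    simp only [addBox, hne, if_true, if_false]
    push_cast at hpi ⊢
    field_simp
    ring
  simp only [dimRatio, hip, if_true, show i ≤ p by omega]
  rw [weylDim_succ] at hw1
  rw [weylDim_succ, weylDim_succ]
  rw [mul_div_assoc', mul_div_assoc', div_eq_div_iff hw1 hw]
  linear_combination weylDim p (addBox μ i) * weylDim p μ * hstep

theorem dimRatio_eq_zero {μ : ℕ → ℤ} {k y : ℕ} (h : k < y) : dimRatio μ k y = 0 :=
  if_neg (by omega)

/-- Abel summation of the staircase weights against the increments of the dimension ratios. -/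
theorem sum_staircase_mul_dimRatio {p i : ℕ} {μ : ℕ → ℤ}
    (h : ∀ a b, 1 ≤ a → a ≤ b → b ≤ p → μ b ≤ μ a) (hi : 1 ≤ i) (c : ℚ) :
    ∑ k ∈ Finset.Icc 1 p, ((μ k : ℚ) + c - 2 * k + 1) * (dimRatio μ k i - dimRatio μ (k - 1) i)
      = ((μ i : ℚ) - i + 1 + (c - p)) * dimRatio μ p i := by
  induction p with
  | zero => simp [dimRatio_eq_zero (show 0 < i by omega)]
  | succ p ih =>
    rw [Finset.sum_Icc_succ_top (by omega), ih fun a b ha hab hb => h a b ha hab (by omega),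
      Nat.add_sub_cancel]
    rcases le_or_gt i (p + 1) with hip | hip
    · have := dimRatio_succ h hi hip
      push_cast at this ⊢
      linear_combination -this
    · simp [dimRatio_eq_zero hip, dimRatio_eq_zero (show p < i by omega)]

theorem dimRatio_mul_dimRatio_addBox {lam : ℕ → ℕ} {i j s : ℕ}
    (h : i ≤ s → weylDim s (addBox (intOf lam) i) ≠ 0) :
    dimRatio (intOf lam) s i * dimRatio (addBox (intOf lam) i) s j = dimR2 lam i j s := by
  unfold dimRatio dimR2
  by_cases hi : i ≤ s <;> by_cases hj : j ≤ s <;> simp [hi, hj]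
  have := h hi
  field_simp

theorem addBox_antitone {d i : ℕ} {μ : ℕ → ℤ}
    (h : ∀ a b, 1 ≤ a → a ≤ b → b ≤ d → μ b ≤ μ a) (hid : i ≤ d)
    (hvalid : i = 1 ∨ μ i < μ (i - 1)) (a b : ℕ) (ha : 1 ≤ a) (hab : a ≤ b) (hb : b ≤ d) :
    addBox μ i b ≤ addBox μ i a := by
  have hba := h a b ha hab hb
  unfold addBox
  by_cases hbi : b = i <;> by_cases hai : a = i <;> simp only [hbi, hai, if_true, if_false]
  · exact le_rfl
  · have := h a (i - 1) ha (by omega) (by omega)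
    have : i ≠ 1 := by omega
    have := hvalid.resolve_left this
    omega
  · subst hai; omega
  · omega

theorem row_boundary_two_step_sum
    (d : ℕ) (hd : 1 ≤ d) (lam : ℕ → ℕ)
    (hlam : ∀ k, 1 ≤ k → k + 1 ≤ d → lam (k + 1) ≤ lam k)
    (i j : ℕ) (hi : i ∈ Finset.Icc 1 d) (hj : j ∈ Finset.Icc 1 d)
    (hvalid : i = 1 ∨ lam i < lam (i - 1)) :
    ∑ k ∈ Finset.Icc 1 d, (staircase d lam k : ℚ) * gcoef lam i j k d
      = ((rowContent lam i - rowContent lam d) * dimR2 lam i j d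
          - (rowContent lam i - rowContent lam d + 1) * dimR2 lam i j (d - 1))
        + (rowContent lam d + 1) * (Fcoef lam i j d d - Fcoef lam i j d (d - 1)) := by
  obtain ⟨hi1, hid⟩ := Finset.mem_Icc.mp hi
  have hanti : ∀ a b, 1 ≤ a → a ≤ b → b ≤ d → intOf lam b ≤ intOf lam a := by
    intro a b ha hab
    induction b, hab using Nat.le_induction with
    | base => exact fun _ => le_rfl
    | succ b hab ih =>
      intro hb
      have := hlam b (by omega) hb
      have := ih (by omega)
      simp only [intOf] at *
      omega
  have hanti' := addBox_antitone hanti hid (by simpa [intOf] using hvalid)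
  have hprod : ∀ s ≤ d, dimRatio (intOf lam) s i * dimRatio (addBox (intOf lam) i) s j
      = dimR2 lam i j s := fun s hs => dimRatio_mul_dimRatio_addBox fun _ =>
    (weylDim_pos fun a b ha hab hb => hanti' a b ha hab (hb.trans hs)).ne'
  have hF : ∀ s t, s ≤ t → Fcoef lam i j s t
      = dimRatio (intOf lam) s i * dimRatio (addBox (intOf lam) i) t j := fun s t hst => if_pos hst
  obtain ⟨p, rfl⟩ : ∃ p, d = p + 1 := ⟨d - 1, by omega⟩
  have hsum := sum_staircase_mul_dimRatio
    (fun a b ha hab hb => hanti a b ha hab (by omega : b ≤ p + 1)) hi1 ((p + 1 : ℕ) : ℚ)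
  have hsum' := sum_staircase_mul_dimRatio (p := p)
    (fun a b ha hab hb => hanti a b ha hab (by omega : b ≤ p + 1)) hi1 ((p + 1 : ℕ) : ℚ)
  have hinit : ∑ k ∈ Finset.Icc 1 p, (staircase (p + 1) lam k : ℚ) * gcoef lam i j k (p + 1)
      = (∑ k ∈ Finset.Icc 1 p, ((intOf lam k : ℚ) + ((p + 1 : ℕ) : ℚ) - 2 * k + 1)
          * (dimRatio (intOf lam) k i - dimRatio (intOf lam) (k - 1) i))
        * (dimRatio (addBox (intOf lam) i) (p + 1) j - dimRatio (addBox (intOf lam) i) p j) := by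
    rw [Finset.sum_mul]
    refine Finset.sum_congr rfl fun k hk => ?_
    have hk := (Finset.mem_Icc.mp hk).2
    rw [gcoef, Nat.add_sub_cancel, hF k (p + 1) (by omega), hF (k - 1) (p + 1) (by omega),
      hF k p hk, hF (k - 1) p (by omega)]
    simp only [staircase, intOf]
    push_cast
    ring
  rw [Finset.sum_Icc_succ_top (by omega)] at hsum ⊢
  rw [hinit, hsum', gcoef, Nat.add_sub_cancel, hF (p + 1) (p + 1) le_rfl, hF p (p + 1) (by omega),
    hF p p le_rfl, ← hprod (p + 1) le_rfl, ← hprod p (by omega)]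
  rw [hsum', Nat.add_sub_cancel] at hsum
  simp only [staircase, rowContent, intOf] at hsum ⊢
  push_cast at hsum ⊢
  linear_combination dimRatio (addBox (intOf lam) i) (p + 1) j * hsum
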